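/- Let 1 ≤ d ≤ n−1, let C ⊆ {0,1}^{n−1} be d-maximum, and let C' ⊆ C be (d−1)-maximum. Let C_1,…,C_k be the C'-connected components of C (unions of the d-cubes of C; every element of a d-maximum class lies in some d-cube). Then for every p ∈ {0,1}^k, the class C* = (C' × {0,1}) ∪ ⋃_{q=1}^{k} (C_q × {p_q}) ⊆ {0,1}^n, obtained by appending both bits to elements of C' and the bit p_q to the elements of C_q, is d-maximum. -/

import Mathlib

open Finset

namespace GeomCompress

/-- `C` shatters the coordinate set `Y`: every pattern on `Y` is realized by some concept. -/
def Shatters {n : ℕ} (C : Finset (Fin n → Bool)) (Y : Finset (Fin n)) : Prop :=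
  ∀ p : Fin n → Bool, ∃ c ∈ C, ∀ i ∈ Y, c i = p i

/-- The VC dimension of `C` equals `d`. -/
def VCDimEq {n : ℕ} (C : Finset (Fin n → Bool)) (d : ℕ) : Prop :=
  (∃ Y : Finset (Fin n), Y.card = d ∧ Shatters C Y) ∧
    ∀ Y : Finset (Fin n), Shatters C Y → Y.card ≤ d

/-- `C` is a `d`-maximum class: VC dimension `d` and maximum possible cardinality. -/
def IsMaximum {n : ℕ} (C : Finset (Fin n → Bool)) (d : ℕ) : Prop :=
  VCDimEq C d ∧ C.card = ∑ i ∈ Finset.range (d + 1), Nat.choose n i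

/-- Hamming distance between two Boolean vectors. -/
def hamming {n : ℕ} (u v : Fin n → Bool) : ℕ :=
  (Finset.univ.filter fun i => u i ≠ v i).card

/-- Adjacency in the one-inclusion graph: differ in exactly one coordinate. -/
def Adj {n : ℕ} (u v : Fin n → Bool) : Prop := hamming u v = 1

instance {n : ℕ} (u v : Fin n → Bool) : Decidable (Adj u v) := by
  unfold Adj; infer_instance

/-- `Q` is a cube of `C` colored by `I`: a subset of `C` whose elements agree outside `I`
and realize all patterns on `I`. -/
def IsCube {n : ℕ} (C Q : Finset (Fin n → Bool)) (I : Finset (Fin n)) : Prop :=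
  Q ⊆ C ∧ (∀ u ∈ Q, ∀ v ∈ Q, ∀ i, i ∉ I → u i = v i) ∧
    ∀ p : Fin n → Bool, ∃ u ∈ Q, ∀ i ∈ I, u i = p i

/-- `v` is a corner vertex of `C`: there is a unique cube of maximum dimension among all
cubes of `C` containing `v`, and all neighbors of `v` in the one-inclusion graph of `C`
lie in that cube. -/
def IsCorner {n : ℕ} (C : Finset (Fin n → Bool)) (v : Fin n → Bool) : Prop :=
  ∃ Q I, IsCube C Q I ∧ v ∈ Q ∧
    (∀ Q' I', IsCube C Q' I' → v ∈ Q' → I'.card ≤ I.card) ∧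
    (∀ Q' I', IsCube C Q' I' → v ∈ Q' → I'.card = I.card → Q' = Q) ∧
    ∀ u ∈ C, Adj u v → u ∈ Q

/-- The class remaining after peeling the first `t` vertices of the ordering `v`. -/
def Peeled {n m : ℕ} (C : Finset (Fin n → Bool)) (v : Fin m → (Fin n → Bool)) (t : Fin m) :
    Finset (Fin n → Bool) :=
  C \ (Finset.univ.filter fun s : Fin m => s < t).image v

/-- `v` is a corner-peeling ordering of `C`: an enumeration of `C` such that each `v t`
is a corner vertex of the class remaining before step `t`. -/
def IsCornerPeeling {n : ℕ} (C : Finset (Fin n → Bool)) (v : Fin C.card → (Fin n → Bool)) :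
    Prop :=
  Function.Injective v ∧ (∀ t, v t ∈ C) ∧ ∀ t, IsCorner (Peeled C v t) (v t)

/-- Degree of `v` in the one-inclusion graph of `C`. -/
def degreeIn {n : ℕ} (C : Finset (Fin n → Bool)) (v : Fin n → Bool) : ℕ :=
  (C.filter fun u => Adj u v).card

/-- The colors of the edges incident to `v` in the one-inclusion graph of `C`. -/
def incidentColors {n : ℕ} (C : Finset (Fin n → Bool)) (v : Fin n → Bool) : Finset (Fin n) :=
  Finset.univ.filter fun i => ∃ u ∈ C, Adj u v ∧ u i ≠ v i

/-- `C` is shortest-path closed: any two concepts are joined in the one-inclusion graph of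
`C` by a path whose length is their Hamming distance. -/
def SPClosed {n : ℕ} (C : Finset (Fin n → Bool)) : Prop :=
  ∀ u ∈ C, ∀ v ∈ C, ∃ p : ℕ → (Fin n → Bool),
    p 0 = u ∧ p (hamming u v) = v ∧ (∀ k ≤ hamming u v, p k ∈ C) ∧
    ∀ k < hamming u v, Adj (p k) (p (k + 1))

/-- `Q` (colored by `I`, with `I.card = d - 1`) is a cube of the boundary `∂C` of the
`d`-maximum class `C`: it is a face of exactly one `d`-cube of `C`. -/
def IsBoundaryCube {n : ℕ} (C : Finset (Fin n → Bool)) (d : ℕ)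
    (Q : Finset (Fin n → Bool)) (I : Finset (Fin n)) : Prop :=
  IsCube C Q I ∧ I.card = d - 1 ∧
    (∃ Q' I', IsCube C Q' I' ∧ I'.card = d ∧ Q ⊆ Q' ∧ I ⊆ I') ∧
    ∀ Q₁ I₁ Q₂ I₂, IsCube C Q₁ I₁ → I₁.card = d → Q ⊆ Q₁ → I ⊆ I₁ →
      IsCube C Q₂ I₂ → I₂.card = d → Q ⊆ Q₂ → I ⊆ I₂ → Q₁ = Q₂

/-- Standard inner product on `Fin d → ℝ`. -/
def dotR {d : ℕ} (x y : Fin d → ℝ) : ℝ := ∑ i, x i * y i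

/-- `x` lies on none of the hyperplanes `⟪a i, ·⟫ = b i`. -/
def OnNoHyperplane {d N : ℕ} (a : Fin N → Fin d → ℝ) (b : Fin N → ℝ) (x : Fin d → ℝ) :
    Prop :=
  ∀ i, dotR (a i) x ≠ b i

/-- The sign vector of the point `x` with respect to the oriented hyperplanes `(a, b)`. -/
noncomputable def signVec {d N : ℕ} (a : Fin N → Fin d → ℝ) (b : Fin N → ℝ)
    (x : Fin d → ℝ) : Fin N → Bool :=
  fun i => decide (b i < dotR (a i) x)

/-- `C` is the concept class induced by the arrangement `(a, b)`: the set of sign vectors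
of points lying on none of the hyperplanes. -/
def IsInducedClass {d N : ℕ} (a : Fin N → Fin d → ℝ) (b : Fin N → ℝ)
    (C : Finset (Fin N → Bool)) : Prop :=
  ∀ c, c ∈ C ↔ ∃ x : Fin d → ℝ, OnNoHyperplane a b x ∧ signVec a b x = c

/-- A simple linear arrangement in `ℝ^d`: every `≤ d` of the hyperplanes are in general
position (normals linearly independent, so every `k ≤ d` of them intersect in an affine
subspace of dimension `d - k`), and every `d+1` of them have empty common intersection. -/
def SimpleArrangement (d : ℕ) {N : ℕ} (a : Fin N → Fin d → ℝ) (b : Fin N → ℝ) : Prop :=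
  (∀ S : Finset (Fin N), S.card ≤ d → LinearIndependent ℝ (fun i : S => a i.1)) ∧
    ∀ S : Finset (Fin N), S.card = d + 1 → ¬∃ x : Fin d → ℝ, ∀ i ∈ S, dotR (a i) x = b i

/-- Membership in the open unit ball (Klein model of hyperbolic space `H^k`). -/
def inBall {k : ℕ} (x : Fin k → ℝ) : Prop := ∑ i, x i ^ 2 < 1

/-- A simple hyperbolic `d`-arrangement in the Klein model `H^k`: every `d` of the
hyperplanes intersect inside the unit ball in a `(k-d)`-dimensional hyperbolic plane
(normals independent and common point inside the ball), and every `d+1` of them have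
empty common intersection inside the ball. -/
def SimpleHyperbolicArrangement (d : ℕ) {k N : ℕ} (a : Fin N → Fin k → ℝ)
    (b : Fin N → ℝ) : Prop :=
  (∀ S : Finset (Fin N), S.card = d →
      LinearIndependent ℝ (fun i : S => a i.1) ∧
        ∃ x : Fin k → ℝ, inBall x ∧ ∀ i ∈ S, dotR (a i) x = b i) ∧
    ∀ S : Finset (Fin N), S.card = d + 1 →
      ¬∃ x : Fin k → ℝ, inBall x ∧ ∀ i ∈ S, dotR (a i) x = b i

/-- The concept class induced by a hyperbolic arrangement: sign vectors of points of the
open unit ball lying on none of the hyperplanes. -/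
def IsInducedClassH {k N : ℕ} (a : Fin N → Fin k → ℝ) (b : Fin N → ℝ)
    (C : Finset (Fin N → Bool)) : Prop :=
  ∀ c, c ∈ C ↔ ∃ x : Fin k → ℝ, inBall x ∧ OnNoHyperplane a b x ∧ signVec a b x = c

/-- A generic arrangement of oriented affine hyperplanes in `ℝ^n`: every subcollection of
`k` hyperplanes, `2 ≤ k ≤ n`, either has empty common intersection or intersects
transversely (normals linearly independent, giving an affine subspace of dim `n - k`). -/
def GenericArrangement {n N : ℕ} (a : Fin N → Fin n → ℝ) (b : Fin N → ℝ) : Prop :=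
  ∀ S : Finset (Fin N), 2 ≤ S.card → S.card ≤ n →
    (¬∃ x : Fin n → ℝ, ∀ i ∈ S, dotR (a i) x = b i) ∨
      LinearIndependent ℝ (fun i : S => a i.1)

/-- `C` is a maximal class of VC dimension `d`: adding any new concept increases the VC
dimension. -/
def IsMaximalClass {n : ℕ} (C : Finset (Fin n → Bool)) (d : ℕ) : Prop :=
  VCDimEq C d ∧
    ∀ c : Fin n → Bool, c ∉ C →
      ∃ Y : Finset (Fin n), d < Y.card ∧ Shatters (insert c C) Y

/-- A path in the one-inclusion graph of `C` avoiding `C'`, from a vertex of `Q1` to a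
vertex of `Q2`. -/
def CConnPath {n : ℕ} (C C' Q1 Q2 : Finset (Fin n → Bool)) : Prop :=
  ∃ (L : ℕ) (p : ℕ → Fin n → Bool),
    p 0 ∈ Q1 ∧ p L ∈ Q2 ∧ (∀ j ≤ L, p j ∈ C ∧ p j ∉ C') ∧
      ∀ j < L, Adj (p j) (p (j + 1))

/-- `Q1` and `Q2` are `d`-cubes of `C` joined by a path of the one-inclusion graph of `C`
avoiding `C'`. -/
def CComponentRel {n : ℕ} (C C' : Finset (Fin n → Bool)) (d : ℕ)
    (Q1 Q2 : Finset (Fin n → Bool)) : Prop :=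
  (∃ I, IsCube C Q1 I ∧ I.card = d) ∧ (∃ I, IsCube C Q2 I ∧ I.card = d) ∧
    CConnPath C C' Q1 Q2

/-- `Comp` enumerates the `C'`-connected components of `C`: each component is a union of
`d`-cubes of `C`, every `d`-cube lies in exactly one component, and two `d`-cubes lie in
the same component iff they are related under the transitive closure of
`C'`-connectedness. -/
def IsComponents {n : ℕ} (C C' : Finset (Fin n → Bool)) (d : ℕ) {k : ℕ}
    (Comp : Fin k → Finset (Fin n → Bool)) : Prop :=
  (∀ q, ∀ x ∈ Comp q, ∃ Q I, IsCube C Q I ∧ I.card = d ∧ x ∈ Q ∧ Q ⊆ Comp q) ∧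
  (∀ Q I, IsCube C Q I → I.card = d → ∃ q, Q ⊆ Comp q) ∧
  (∀ q q' Q I, IsCube C Q I → I.card = d → Q ⊆ Comp q → Q ⊆ Comp q' → q = q') ∧
  ∀ q Q1 I1, IsCube C Q1 I1 → I1.card = d → Q1 ⊆ Comp q →
    ∀ Q2 I2, IsCube C Q2 I2 → I2.card = d →
      (Q2 ⊆ Comp q ↔ Relation.TransGen (CComponentRel C C' d) Q1 Q2)

/-- Append the bit `b` as a new last coordinate. -/
def app {n : ℕ} (c : Fin n → Bool) (b : Bool) : Fin (n + 1) → Bool := Fin.snoc c b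

/-- The lift `(C' × {0,1}) ∪ ⋃_q (Comp q × {p q})`. -/
def LiftClass {n k : ℕ} (C' : Finset (Fin n → Bool))
    (Comp : Fin k → Finset (Fin n → Bool)) (p : Fin k → Bool) :
    Finset (Fin (n + 1) → Bool) :=
  C'.image (fun c => app c false) ∪ C'.image (fun c => app c true) ∪
    Finset.univ.biUnion fun q => (Comp q).image fun c => app c (p q)

lemma eq_of_ne_of_ne {a b c : Bool} (hab : a ≠ b) (hac : a ≠ c) : b = c := by
  revert a b c
  decide

/-- The coordinate sets shattered by `C`. -/
noncomputable def shatteredSets {n : ℕ} (C : Finset (Fin n → Bool)) :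
    Finset (Finset (Fin n)) := by
  classical exact Finset.univ.filter (Shatters C)

/-- `C` is extremal (ample) if it has as many elements as shattered sets. -/
def IsExtremal {n : ℕ} (C : Finset (Fin n → Bool)) : Prop :=
  (shatteredSets C).card = C.card

section

variable {n : ℕ} {C D : Finset (Fin n → Bool)}

lemma mem_shatteredSets {Y : Finset (Fin n)} : Y ∈ shatteredSets C ↔ Shatters C Y := by
  simp [shatteredSets]

lemma Shatters.mono_left {Y : Finset (Fin n)} (h : Shatters D Y) (hDC : D ⊆ C) :
    Shatters C Y := fun p => by
  obtain ⟨c, hc, h'⟩ := h p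
  exact ⟨c, hDC hc, h'⟩

lemma Shatters.mono_right {Y Z : Finset (Fin n)} (h : Shatters C Z) (hYZ : Y ⊆ Z) :
    Shatters C Y := fun p => by
  obtain ⟨c, hc, h'⟩ := h p
  exact ⟨c, hc, fun i hi => h' i (hYZ hi)⟩

lemma Shatters.notMem {Y : Finset (Fin n)} {i : Fin n} {b : Bool} (h : Shatters C Y)
    (hb : ∀ c ∈ C, c i = b) : i ∉ Y := fun hi => by
  obtain ⟨c, hc, h'⟩ := h fun _ => !b
  have h1 := hb c hc
  have h2 := h' i hi
  simp_all

lemma Shatters.insert_of_filter {Y : Finset (Fin n)} {i : Fin n}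
    (h : ∀ b, Shatters (C.filter fun c => c i = b) Y) : Shatters C (insert i Y) := fun p => by
  obtain ⟨c, hc, h'⟩ := h (p i) p
  simp only [Finset.mem_filter] at hc
  refine ⟨c, hc.1, fun j hj => ?_⟩
  rcases Finset.mem_insert.1 hj with rfl | hj
  exacts [hc.2, h' j hj]

lemma card_filter_add_card_filter (C : Finset (Fin n → Bool)) (i : Fin n) :
    (C.filter fun c => c i = false).card + (C.filter fun c => c i = true).card = C.card := by
  rw [add_comm, ← Finset.card_filter_add_card_filter_not (s := C) (fun c => c i = true)]
  simp

lemma card_shatteredSets_filter_add_le (C : Finset (Fin n → Bool)) (i : Fin n) :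
    (shatteredSets (C.filter fun c => c i = false)).card +
      (shatteredSets (C.filter fun c => c i = true)).card ≤ (shatteredSets C).card := by
  classical
  have hnot : ∀ b, ∀ Y ∈ shatteredSets (C.filter fun c => c i = b), i ∉ Y := fun b Y hY =>
    (mem_shatteredSets.1 hY).notMem fun c hc => (Finset.mem_filter.1 hc).2
  set A := shatteredSets (C.filter fun c => c i = false)
  set B := shatteredSets (C.filter fun c => c i = true)
  have hinj : ((A ∩ B).image (insert i)).card = (A ∩ B).card := by
    refine Finset.card_image_of_injOn fun Y hY Z hZ h => ?_
    have hY' := hnot _ Y (Finset.mem_inter.1 hY).1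
    have hZ' := hnot _ Z (Finset.mem_inter.1 hZ).1
    rw [← Finset.erase_insert hY', ← Finset.erase_insert hZ']
    exact congrArg (Finset.erase · i) h
  have hdisj : Disjoint (A ∪ B) ((A ∩ B).image (insert i)) := by
    refine Finset.disjoint_left.2 fun Y hY hY' => ?_
    obtain ⟨Z, -, rfl⟩ := Finset.mem_image.1 hY'
    rcases Finset.mem_union.1 hY with h | h
    exacts [hnot _ _ h (Finset.mem_insert_self _ _), hnot _ _ h (Finset.mem_insert_self _ _)]
  rw [← Finset.card_union_add_card_inter, ← hinj, ← Finset.card_union_of_disjoint hdisj]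
  refine Finset.card_le_card (Finset.union_subset (Finset.union_subset ?_ ?_) ?_)
  · exact fun Y hY => mem_shatteredSets.2
      ((mem_shatteredSets.1 hY).mono_left (Finset.filter_subset _ _))
  · exact fun Y hY => mem_shatteredSets.2
      ((mem_shatteredSets.1 hY).mono_left (Finset.filter_subset _ _))
  · intro Y hY
    obtain ⟨Z, hZ, rfl⟩ := Finset.mem_image.1 hY
    rw [Finset.mem_inter] at hZ
    refine mem_shatteredSets.2 (Shatters.insert_of_filter fun b => ?_)
    cases b
    exacts [mem_shatteredSets.1 hZ.1, mem_shatteredSets.1 hZ.2]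

/-- Pajor's inequality. -/
lemma card_le_card_shatteredSets (C : Finset (Fin n → Bool)) :
    C.card ≤ (shatteredSets C).card := by
  induction hm : C.card using Nat.strong_induction_on generalizing C with
  | _ m ih =>
    subst hm
    rcases C.eq_empty_or_nonempty with rfl | hne
    · simp
    by_cases h1 : C.card ≤ 1
    · refine h1.trans (Finset.card_pos.2 ⟨∅, mem_shatteredSets.2 fun p => ?_⟩)
      obtain ⟨c, hc⟩ := hne
      exact ⟨c, hc, by simp⟩
    obtain ⟨x, hx, y, hy, hxy⟩ := Finset.one_lt_card.1 (not_le.1 h1)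
    obtain ⟨i, hi⟩ := Function.ne_iff.1 hxy
    have hpos : ∀ b, 0 < (C.filter fun c => c i = b).card := fun b => by
      rw [Finset.card_pos]
      by_cases hb : x i = b
      · exact ⟨x, by simp [hx, hb]⟩
      · exact ⟨y, by simpa [hy] using eq_of_ne_of_ne hi hb⟩
    have hsum := card_filter_add_card_filter C i
    have h0 := hpos false
    have h1 := hpos true
    have := card_shatteredSets_filter_add_le C i
    have := ih _ (by omega) (C.filter fun c => c i = false) rfl
    have := ih _ (by omega) (C.filter fun c => c i = true) rfl
    omega

lemma IsExtremal.filter_eq (hC : IsExtremal C) (i : Fin n) (b : Bool) :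
    IsExtremal (C.filter fun c => c i = b) := by
  have hsum := card_filter_add_card_filter C i
  have := card_shatteredSets_filter_add_le C i
  have h0 := card_le_card_shatteredSets (C.filter fun c => c i = false)
  have h1 := card_le_card_shatteredSets (C.filter fun c => c i = true)
  unfold IsExtremal at *
  cases b <;> omega

/-- The intersection of an extremal class with a face of the cube is extremal. -/
lemma IsExtremal.filter_forall_eq (hC : IsExtremal C) (I : Finset (Fin n))
    (π : Fin n → Bool) : IsExtremal (C.filter fun c => ∀ i ∈ I, c i = π i) := by
  classical
  induction I using Finset.induction_on with
  | empty => simpa using hC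
  | insert j I _ ih =>
    have := ih.filter_eq j (π j)
    rw [Finset.filter_filter] at this
    simpa [Finset.forall_mem_insert, and_comm] using this

lemma hamming_eq_zero {x y : Fin n → Bool} : hamming x y = 0 ↔ x = y := by
  simp [hamming, Finset.filter_eq_empty_iff, funext_iff]

lemma IsExtremal.exists_between (hC : IsExtremal C) {x y : Fin n → Bool} (hx : x ∈ C)
    (hy : y ∈ C) (hxy : 2 ≤ hamming x y) :
    ∃ z ∈ C, hamming x z < hamming x y ∧ hamming z y < hamming x y ∧ z ≠ x := by
  classical
  by_contra! hcon
  set I := Finset.univ.filter fun i => x i = y i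
  have hD := hC.filter_forall_eq I x
  have hDeq : (C.filter fun c => ∀ i ∈ I, c i = x i) = {x, y} := by
    ext z
    simp only [Finset.mem_filter, Finset.mem_insert, Finset.mem_singleton]
    constructor
    · rintro ⟨hz, hzI⟩
      by_contra! hne
      have hz' : ∀ i, x i = y i → z i = x i := fun i hi => hzI i (by simpa [I] using hi)
      refine hne.1 (hcon z hz ?_ ?_)
      · obtain ⟨j, hj⟩ := Function.ne_iff.1 hne.2
        refine Finset.card_lt_card ((Finset.ssubset_iff_of_subset ?_).2 ⟨j, ?_, ?_⟩)
        · intro i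
          simpa using fun hi h => hi (hz' i h).symm
        · simpa using fun h => hj ((hz' j h).trans h)
        · simpa using by_contra fun h => hj (eq_of_ne_of_ne h fun h' => hj ((hz' j h').trans h'))
      · obtain ⟨j, hj⟩ := Function.ne_iff.1 hne.1
        refine Finset.card_lt_card ((Finset.ssubset_iff_of_subset ?_).2 ⟨j, ?_, ?_⟩)
        · intro i
          simpa using fun hi h => hi ((hz' i h).trans h)
        · simpa using fun h => hj (hz' j h)
        · simpa using eq_of_ne_of_ne (Ne.symm hj) fun h => hj (hz' j h)
    · rintro (rfl | rfl)
      · exact ⟨hx, fun _ _ => rfl⟩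
      · exact ⟨hy, fun i hi => by simpa [I, eq_comm] using hi⟩
  rw [hDeq] at hD
  set J := Finset.univ.filter fun i => x i ≠ y i
  have hsub : insert ∅ (J.image fun i => ({i} : Finset (Fin n))) ⊆
      shatteredSets ({x, y} : Finset (Fin n → Bool)) := by
    intro Y hY
    rw [mem_shatteredSets]
    rcases Finset.mem_insert.1 hY with rfl | hY
    · exact fun p => ⟨x, by simp, by simp⟩
    · obtain ⟨i, hi, rfl⟩ := Finset.mem_image.1 hY
      have hi' : x i ≠ y i := by simpa [J] using hi
      intro p
      by_cases hp : x i = p i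
      · exact ⟨x, by simp, by simpa using hp⟩
      · exact ⟨y, by simp, by simpa using eq_of_ne_of_ne hi' hp⟩
  have hcard := Finset.card_le_card hsub
  rw [hD, Finset.card_insert_of_notMem (by simp),
    Finset.card_image_of_injective _ Finset.singleton_injective] at hcard
  have h2 : ({x, y} : Finset (Fin n → Bool)).card ≤ 2 := Finset.card_le_two
  have h3 : J.card = hamming x y := rfl
  omega

lemma IsExtremal.exists_adj (hC : IsExtremal C) {x y : Fin n → Bool} (hx : x ∈ C)
    (hy : y ∈ C) (hxy : x ≠ y) : ∃ z ∈ C, Adj x z := by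
  induction hm : hamming x y using Nat.strong_induction_on generalizing y with
  | _ m ih =>
    subst hm
    have h0 : hamming x y ≠ 0 := fun h => hxy (hamming_eq_zero.1 h)
    by_cases h1 : hamming x y = 1
    · exact ⟨y, hy, h1⟩
    obtain ⟨z, hz, hlt, -, hne⟩ := hC.exists_between hx hy (by omega)
    exact ih _ hlt hz hne.symm rfl

lemma Adj.exists_eq_update {x z : Fin n → Bool} (h : Adj x z) :
    ∃ i, z = Function.update x i (!x i) := by
  obtain ⟨i, hi⟩ := Finset.card_eq_one.1 h
  refine ⟨i, funext fun j => ?_⟩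
  have hj : x j ≠ z j ↔ j = i := by simpa using Finset.ext_iff.1 hi j
  by_cases hji : j = i
  · subst hji
    have := hj.2 rfl
    rw [Function.update_self]
    exact Bool.eq_not.2 (Ne.symm this)
  · rw [Function.update_of_ne hji]
    exact (not_not.1 fun h => hji (hj.1 h)).symm

/-- The reduction of `C` along the coordinate `i`, embedded in the facet where coordinate
`i` is `false`. -/
def reduction (C : Finset (Fin n → Bool)) (i : Fin n) : Finset (Fin n → Bool) :=
  C.filter fun c => c i = false ∧ Function.update c i true ∈ C

lemma update_mem_of_mem_reduction {c : Fin n → Bool} {i : Fin n} (hc : c ∈ reduction C i)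
    (b : Bool) : Function.update c i b ∈ C := by
  simp only [reduction, Finset.mem_filter] at hc
  cases b
  · rw [← hc.2.1, Function.update_eq_self]
    exact hc.1
  · exact hc.2.2

lemma Shatters.insert_of_reduction {Y : Finset (Fin n)} {i : Fin n}
    (h : Shatters (reduction C i) Y) : i ∉ Y ∧ Shatters C (insert i Y) := by
  have hi : i ∉ Y := h.notMem (b := false) fun c hc => (Finset.mem_filter.1 hc).2.1
  refine ⟨hi, fun p => ?_⟩
  obtain ⟨c, hc, h'⟩ := h p
  refine ⟨_, update_mem_of_mem_reduction hc (p i), fun j hj => ?_⟩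
  by_cases hji : j = i
  · subst hji
    simp
  · rw [Function.update_of_ne hji]
    exact h' j ((Finset.mem_insert.1 hj).resolve_left hji)

lemma card_image_update_add_card_reduction (C : Finset (Fin n → Bool)) (i : Fin n) :
    (C.image fun c => Function.update c i false).card + (reduction C i).card = C.card := by
  classical
  set A := C.filter fun c => c i = false
  set B := (C.filter fun c => c i = true).image fun c => Function.update c i false
  have hup : ∀ c : Fin n → Bool, ∀ b, c i = b →
      Function.update (Function.update c i !b) i b = c := by
    rintro c b rfl
    simp
  have hunion : (C.image fun c => Function.update c i false) = A ∪ B := by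
    ext c
    simp only [Finset.mem_image, Finset.mem_union, Finset.mem_filter, A, B]
    constructor
    · rintro ⟨a, ha, rfl⟩
      cases h : a i
      · left
        rw [show Function.update a i false = a by rw [← h, Function.update_eq_self]]
        exact ⟨ha, h⟩
      · exact Or.inr ⟨a, ⟨ha, h⟩, rfl⟩
    · rintro (⟨hc, h⟩ | ⟨a, ⟨ha, -⟩, rfl⟩)
      · exact ⟨c, hc, by rw [← h, Function.update_eq_self]⟩
      · exact ⟨a, ha, rfl⟩
  have hinter : reduction C i = A ∩ B := by
    ext c
    simp only [Finset.mem_image, Finset.mem_inter, Finset.mem_filter, A, B, reduction]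
    constructor
    · rintro ⟨hc, h, hc'⟩
      exact ⟨⟨hc, h⟩, _, ⟨hc', by simp⟩, hup c false h⟩
    · rintro ⟨⟨hc, h⟩, a, ⟨ha, h'⟩, rfl⟩
      exact ⟨hc, h, by rw [show Function.update (Function.update a i false) i true = a from
        hup a true h']; exact ha⟩
  have hB : B.card = (C.filter fun c => c i = true).card := by
    refine Finset.card_image_of_injOn fun a ha b hb hab => ?_
    have ha' := hup a true (Finset.mem_filter.1 ha).2
    have hb' := hup b true (Finset.mem_filter.1 hb).2
    rw [← ha', ← hb']
    exact congrArg (Function.update · i true) hab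
  rw [hunion, hinter, Finset.card_union_add_card_inter, hB, card_filter_add_card_filter]

lemma Shatters.of_image_update {Y : Finset (Fin n)} {i : Fin n}
    (h : Shatters (C.image fun c => Function.update c i false) Y) : i ∉ Y ∧ Shatters C Y := by
  have hi : i ∉ Y := h.notMem (b := false) fun c hc => by
    obtain ⟨a, -, rfl⟩ := Finset.mem_image.1 hc
    simp
  refine ⟨hi, fun p => ?_⟩
  obtain ⟨c, hc, h'⟩ := h p
  obtain ⟨a, ha, rfl⟩ := Finset.mem_image.1 hc
  refine ⟨a, ha, fun j hj => ?_⟩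
  have := h' j hj
  rwa [Function.update_of_ne (by rintro rfl; exact hi hj)] at this

/-- The reduction of an extremal class is extremal, and its shattered sets are the links of
the shattered sets of the class. -/
lemma IsExtremal.reduction (hC : IsExtremal C) (i : Fin n) :
    IsExtremal (reduction C i) ∧ ∀ Y : Finset (Fin n),
      Shatters (GeomCompress.reduction C i) Y ↔ i ∉ Y ∧ Shatters C (insert i Y) := by
  classical
  set R := GeomCompress.reduction C i
  set P := C.image fun c => Function.update c i false
  have hP : shatteredSets P ⊆ (shatteredSets C).filter fun Y => ¬ i ∈ Y := fun Y hY => by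
    have := (mem_shatteredSets.1 hY).of_image_update
    exact Finset.mem_filter.2 ⟨mem_shatteredSets.2 this.2, this.1⟩
  have hR : (shatteredSets R).image (insert i) ⊆ (shatteredSets C).filter fun Y => i ∈ Y := by
    intro Y hY
    obtain ⟨Z, hZ, rfl⟩ := Finset.mem_image.1 hY
    exact Finset.mem_filter.2 ⟨mem_shatteredSets.2
      (mem_shatteredSets.1 hZ).insert_of_reduction.2, Finset.mem_insert_self _ _⟩
  have hinj : ((shatteredSets R).image (insert i)).card = (shatteredSets R).card := by
    refine Finset.card_image_of_injOn fun Y hY Z hZ h => ?_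
    have hY' := (mem_shatteredSets.1 hY).insert_of_reduction.1
    have hZ' := (mem_shatteredSets.1 hZ).insert_of_reduction.1
    rw [← Finset.erase_insert hY', ← Finset.erase_insert hZ']
    exact congrArg (Finset.erase · i) h
  have h1 : P.card + R.card = C.card := card_image_update_add_card_reduction C i
  have h2 := Finset.card_filter_add_card_filter_not (s := shatteredSets C) (fun Y => i ∈ Y)
  have h3 := card_le_card_shatteredSets P
  have h4 := card_le_card_shatteredSets R
  have h5 := Finset.card_le_card hP
  have h6 := Finset.card_le_card hR
  unfold IsExtremal at *
  have h7 := Finset.eq_of_subset_of_card_le hR (by omega)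
  refine ⟨by omega, fun Y => ⟨Shatters.insert_of_reduction, fun ⟨hi, hY⟩ => ?_⟩⟩
  have hmem : insert i Y ∈ (shatteredSets R).image (insert i) := by
    rw [h7]
    exact Finset.mem_filter.2 ⟨mem_shatteredSets.2 hY, Finset.mem_insert_self _ _⟩
  obtain ⟨Z, hZ, hZY⟩ := Finset.mem_image.1 hmem
  have hZ' := mem_shatteredSets.1 hZ
  rwa [← Finset.erase_insert hZ'.insert_of_reduction.1, hZY, Finset.erase_insert hi] at hZ'

lemma IsCube.of_reduction {Q : Finset (Fin n → Bool)} {I : Finset (Fin n)} {i : Fin n}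
    (hQ : IsCube (reduction C i) Q I) :
    i ∉ I ∧ IsCube C (Q ∪ Q.image fun c => Function.update c i true) (insert i I) := by
  obtain ⟨hsub, hagree, hpat⟩ := hQ
  have hfalse : ∀ c ∈ Q, c i = false := fun c hc => (Finset.mem_filter.1 (hsub hc)).2.1
  have hi : i ∉ I := Shatters.notMem hpat hfalse
  refine ⟨hi, ?_, ?_, fun p => ?_⟩
  · refine Finset.union_subset (fun c hc => (Finset.mem_filter.1 (hsub hc)).1) fun c hc => ?_
    obtain ⟨a, ha, rfl⟩ := Finset.mem_image.1 hc
    exact update_mem_of_mem_reduction (hsub ha) true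
  · have key : ∀ u ∈ Q ∪ Q.image (fun c => Function.update c i true), ∃ a ∈ Q,
        ∀ j, j ≠ i → u j = a j := by
      intro u hu
      rcases Finset.mem_union.1 hu with hu | hu
      · exact ⟨u, hu, fun _ _ => rfl⟩
      · obtain ⟨a, ha, rfl⟩ := Finset.mem_image.1 hu
        exact ⟨a, ha, fun j hj => Function.update_of_ne hj _ _⟩
    intro u hu v hv j hj
    rw [Finset.mem_insert, not_or] at hj
    obtain ⟨a, ha, hua⟩ := key u hu
    obtain ⟨b, hb, hvb⟩ := key v hv
    rw [hua j hj.1, hvb j hj.1, hagree a ha b hb j hj.2]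
  · obtain ⟨u, hu, hup⟩ := hpat p
    cases hp : p i
    · refine ⟨u, Finset.mem_union_left _ hu, fun j hj => ?_⟩
      rcases Finset.mem_insert.1 hj with rfl | hj
      exacts [(hfalse u hu).trans hp.symm, hup j hj]
    · refine ⟨_, Finset.mem_union_right _ (Finset.mem_image_of_mem _ hu), fun j hj => ?_⟩
      by_cases hji : j = i
      · subst hji
        simp [hp]
      · rw [Function.update_of_ne hji]
        exact hup j ((Finset.mem_insert.1 hj).resolve_left hji)

lemma IsExtremal.exists_isCube {d : ℕ} {S : Finset (Fin n)} (hC : IsExtremal C)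
    (hdS : d ≤ S.card) (hS : ∀ Y, Shatters C Y ↔ Y ⊆ S ∧ Y.card ≤ d) {c : Fin n → Bool}
    (hc : c ∈ C) : ∃ Q I, IsCube C Q I ∧ I.card = d ∧ c ∈ Q := by
  classical
  induction d generalizing C S c with
  | zero =>
    refine ⟨{c}, ∅, ⟨by simpa using hc, ?_, fun p => ⟨c, by simp, by simp⟩⟩, rfl, by simp⟩
    simp
  | succ d ih =>
    obtain ⟨j, hj⟩ : S.Nonempty := Finset.card_pos.1 (by omega)
    obtain ⟨y, hy, hyj⟩ := (hS {j}).2 ⟨by simpa using hj, by simp⟩ fun _ => !c j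
    have hyj : y j = !c j := hyj j (by simp)
    have hcy : c ≠ y := fun h => by simp [h] at hyj
    obtain ⟨z, hz, hcz⟩ := hC.exists_adj hc hy hcy
    obtain ⟨i, rfl⟩ := hcz.exists_eq_update
    have hb : ∀ b, Function.update c i b ∈ C := fun b => by
      by_cases h : b = c i
      · subst h
        simpa using hc
      · rwa [show b = !c i by cases b <;> cases h' : c i <;> simp_all]
    have hred : Function.update c i false ∈ GeomCompress.reduction C i := by
      simp [GeomCompress.reduction, hb]
    have hiS : i ∈ S := by
      have : Shatters C {i} := fun p => ⟨_, hb (p i), by simp⟩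
      simpa using ((hS _).1 this).1
    obtain ⟨hext, hsh⟩ := hC.reduction i
    obtain ⟨Q, I, hQ, hI, hcQ⟩ := ih (S := S.erase i) hext
      (by rw [Finset.card_erase_of_mem hiS]; omega) (fun Y => by
        rw [hsh, hS, Finset.insert_subset_iff, Finset.subset_erase]
        constructor
        · rintro ⟨h1, ⟨-, h2⟩, h3⟩
          rw [Finset.card_insert_of_notMem h1] at h3
          exact ⟨⟨h2, h1⟩, by omega⟩
        · rintro ⟨⟨h2, h1⟩, h3⟩
          rw [Finset.card_insert_of_notMem h1]
          exact ⟨h1, ⟨hiS, h2⟩, by omega⟩) hred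
    obtain ⟨hiI, hQ'⟩ := hQ.of_reduction
    refine ⟨_, _, hQ', by rw [Finset.card_insert_of_notMem hiI, hI], ?_⟩
    cases h : c i
    · rw [← h, Function.update_eq_self] at hcQ
      exact Finset.mem_union_left _ hcQ
    · exact Finset.mem_union_right _ (Finset.mem_image.2 ⟨_, hcQ, by simp [← h]⟩)

lemma card_filter_card_le (n d : ℕ) :
    (Finset.univ.filter fun Y : Finset (Fin n) => Y.card ≤ d).card =
      ∑ i ∈ Finset.range (d + 1), n.choose i := by
  rw [Finset.card_eq_sum_card_fiberwise (f := Finset.card) (t := Finset.range (d + 1))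
    (fun Y hY => by simpa [Nat.lt_succ_iff] using hY)]
  refine Finset.sum_congr rfl fun i hi => ?_
  have hcard := Finset.card_powersetCard i (Finset.univ : Finset (Fin n))
  rw [Finset.card_fin] at hcard
  rw [← hcard, Finset.filter_filter]
  refine congrArg Finset.card (Finset.ext fun Y => ?_)
  simp only [Finset.mem_range, Finset.mem_filter, Finset.mem_powersetCard] at hi ⊢
  simp only [Finset.mem_univ, Finset.subset_univ, true_and]
  omega

lemma IsMaximum.shatters_iff {d : ℕ} (hC : IsMaximum C d) (Y : Finset (Fin n)) :
    Shatters C Y ↔ Y.card ≤ d := by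
  classical
  have hsub : shatteredSets C ⊆ Finset.univ.filter fun Y : Finset (Fin n) => Y.card ≤ d :=
    fun Y hY => by simpa using hC.1.2 Y (mem_shatteredSets.1 hY)
  have heq := Finset.eq_of_subset_of_card_le hsub
    (by rw [card_filter_card_le, ← hC.2]; exact card_le_card_shatteredSets C)
  rw [← mem_shatteredSets, heq]
  simp

lemma IsMaximum.isExtremal {d : ℕ} (hC : IsMaximum C d) : IsExtremal C := by
  classical
  rw [IsExtremal, hC.2, ← card_filter_card_le]
  refine congrArg Finset.card (Finset.ext fun Y => ?_)
  rw [mem_shatteredSets, hC.shatters_iff]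
  simp

lemma IsMaximum.exists_isCube {d : ℕ} (hC : IsMaximum C d) {c : Fin n → Bool} (hc : c ∈ C) :
    ∃ Q I, IsCube C Q I ∧ I.card = d ∧ c ∈ Q := by
  obtain ⟨Y, hY, -⟩ := hC.1.1
  refine hC.isExtremal.exists_isCube (S := Finset.univ) ?_ (fun Y => ?_) hc
  · exact hY ▸ Finset.card_le_card (Finset.subset_univ Y)
  · simp [hC.shatters_iff]

section Components

variable {C' : Finset (Fin n → Bool)} {d k : ℕ} {Comp : Fin k → Finset (Fin n → Bool)}

lemma IsComponents.subset (h : IsComponents C C' d Comp) (q : Fin k) : Comp q ⊆ C :=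
  fun x hx => by
    obtain ⟨Q, I, hQ, -, hxQ, -⟩ := h.1 q x hx
    exact hQ.1 hxQ

lemma IsComponents.exists_mem (h : IsComponents C C' d Comp) (hC : IsMaximum C d)
    {x : Fin n → Bool} (hx : x ∈ C) : ∃ q, x ∈ Comp q := by
  obtain ⟨Q, I, hQ, hI, hxQ⟩ := hC.exists_isCube hx
  obtain ⟨q, hq⟩ := h.2.1 Q I hQ hI
  exact ⟨q, hq hxQ⟩

lemma IsComponents.eq_of_hamming_le_one (h : IsComponents C C' d Comp) {x y : Fin n → Bool}
    {q q' : Fin k} (hx : x ∈ Comp q) (hy : y ∈ Comp q') (hxC' : x ∉ C') (hyC' : y ∉ C')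
    (hxy : hamming x y ≤ 1) : q = q' := by
  have hxC := h.subset q hx
  have hyC := h.subset q' hy
  obtain ⟨Q, I, hQ, hI, hxQ, hQq⟩ := h.1 q x hx
  obtain ⟨Q', I', hQ', hI', hyQ', hQcomp⟩ := h.1 q' y hy
  have hpath : CConnPath C C' Q Q' := by
    rcases Nat.le_one_iff_eq_zero_or_eq_one.1 hxy with h0 | h1
    · obtain rfl := hamming_eq_zero.1 h0
      exact ⟨0, fun _ => x, hxQ, hyQ', fun _ _ => ⟨hxC, hxC'⟩, by simp⟩
    · refine ⟨1, fun j => if j = 0 then x else y, by simpa, by simpa, fun j _ => ?_,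
        fun j hj => ?_⟩
      · dsimp only
        split_ifs
        exacts [⟨hxC, hxC'⟩, ⟨hyC, hyC'⟩]
      · obtain rfl : j = 0 := by omega
        simpa [Adj] using h1
  have hrel : CComponentRel C C' d Q Q' := ⟨⟨I, hQ, hI⟩, ⟨I', hQ', hI'⟩, hpath⟩
  exact h.2.2.1 q q' Q' I' hQ' hI'
    ((h.2.2.2 q Q I hQ hI hQq Q' I' hQ' hI').2 (.single hrel)) hQcomp

/-- An extremal subclass avoiding `C'` meets only one `C'`-connected component. -/
lemma IsComponents.eq_of_isExtremal (h : IsComponents C C' d Comp) (hC : IsMaximum C d)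
    (hD : IsExtremal D) (hDC : D ⊆ C) (hDC' : ∀ x ∈ D, x ∉ C') {x y : Fin n → Bool}
    {q q' : Fin k} (hxD : x ∈ D) (hyD : y ∈ D) (hx : x ∈ Comp q) (hy : y ∈ Comp q') :
    q = q' := by
  induction hm : hamming x y using Nat.strong_induction_on generalizing x y q q' with
  | _ m ih =>
    subst hm
    by_cases h1 : hamming x y ≤ 1
    · exact h.eq_of_hamming_le_one hx hy (hDC' x hxD) (hDC' y hyD) h1
    obtain ⟨z, hzD, hxz, hzy, -⟩ := hD.exists_between hxD hyD (by omega)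
    obtain ⟨r, hr⟩ := h.exists_mem hC (hDC hzD)
    exact (ih _ hxz hxD hzD hx hr rfl).trans (ih _ hzy hzD hyD hr hy rfl)

@[simp] lemma app_castSucc (c : Fin n → Bool) (b : Bool) (i : Fin n) :
    app c b i.castSucc = c i := by
  simp [app]

@[simp] lemma app_last (c : Fin n → Bool) (b : Bool) : app c b (Fin.last n) = b := by
  simp [app]

lemma app_injective (b : Bool) : Function.Injective fun c : Fin n → Bool => app c b :=
  fun c c' h => funext fun i => by simpa using congrFun h i.castSucc

lemma mem_liftClass {p : Fin k → Bool} {x : Fin (n + 1) → Bool} :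
    x ∈ LiftClass C' Comp p ↔
      ∃ c b, app c b = x ∧ (c ∈ C' ∨ ∃ q, c ∈ Comp q ∧ p q = b) := by
  simp only [LiftClass, Finset.mem_union, Finset.mem_image, Finset.mem_biUnion,
    Finset.mem_univ, true_and]
  constructor
  · rintro ((⟨c, hc, rfl⟩ | ⟨c, hc, rfl⟩) | ⟨q, c, hc, rfl⟩)
    exacts [⟨c, _, rfl, .inl hc⟩, ⟨c, _, rfl, .inl hc⟩, ⟨c, _, rfl, .inr ⟨q, hc, rfl⟩⟩]
  · rintro ⟨c, b, rfl, hc | ⟨q, hc, rfl⟩⟩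
    · cases b
      exacts [.inl (.inl ⟨c, hc, rfl⟩), .inl (.inr ⟨c, hc, rfl⟩)]
    · exact .inr ⟨q, c, hc, rfl⟩

lemma IsComponents.card_liftClass (h : IsComponents C C' d Comp) (hC : IsMaximum C d)
    (hsub : C' ⊆ C) (p : Fin k → Bool) :
    (LiftClass C' Comp p).card = C.card + C'.card := by
  classical
  set A : Bool → Finset (Fin n → Bool) := fun b =>
    C.filter fun c => c ∈ C' ∨ ∃ q, c ∈ Comp q ∧ p q = b
  have hlift : LiftClass C' Comp p =
      (A false).image (fun c => app c false) ∪ (A true).image fun c => app c true := by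
    ext x
    have hA : ∀ c b, c ∈ A b ↔ c ∈ C' ∨ ∃ q, c ∈ Comp q ∧ p q = b := fun c b => by
      simp only [A, Finset.mem_filter, and_iff_right_iff_imp]
      rintro (hc | ⟨q, hc, -⟩)
      exacts [hsub hc, h.subset q hc]
    simp only [mem_liftClass, ← hA, Finset.mem_union, Finset.mem_image]
    constructor
    · rintro ⟨c, (_ | _), rfl, hc⟩
      exacts [.inl ⟨c, hc, rfl⟩, .inr ⟨c, hc, rfl⟩]
    · rintro (⟨c, hc, rfl⟩ | ⟨c, hc, rfl⟩)
      exacts [⟨c, _, rfl, hc⟩, ⟨c, _, rfl, hc⟩]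
  have hdisj : Disjoint ((A false).image fun c => app c false)
      ((A true).image fun c => app c true) := by
    refine Finset.disjoint_left.2 fun x hx hx' => ?_
    obtain ⟨c, -, rfl⟩ := Finset.mem_image.1 hx
    obtain ⟨c', -, hcc'⟩ := Finset.mem_image.1 hx'
    simpa using congrFun hcc' (Fin.last n)
  have hunion : A false ∪ A true = C := by
    refine Finset.Subset.antisymm
      (Finset.union_subset (Finset.filter_subset _ _) (Finset.filter_subset _ _)) fun c hc => ?_
    obtain ⟨q, hq⟩ := h.exists_mem hC hc
    simp only [A, Finset.mem_union, Finset.mem_filter]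
    cases hp : p q
    exacts [.inl ⟨hc, .inr ⟨q, hq, hp⟩⟩, .inr ⟨hc, .inr ⟨q, hq, hp⟩⟩]
  have hinter : A false ∩ A true = C' := by
    ext c
    simp only [A, Finset.mem_inter, Finset.mem_filter]
    constructor
    · rintro ⟨⟨-, hc | ⟨q, hq, hp⟩⟩, -, hc' | ⟨q', hq', hp'⟩⟩
      any_goals assumption
      by_contra hcC'
      obtain rfl := h.eq_of_hamming_le_one hq hq' hcC' hcC'
        (by rw [hamming_eq_zero.2 rfl]; exact zero_le_one)
      simp [hp] at hp'
    · exact fun hc => ⟨⟨hsub hc, .inl hc⟩, hsub hc, .inl hc⟩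
  rw [hlift, Finset.card_union_of_disjoint hdisj,
    Finset.card_image_of_injective _ (app_injective _),
    Finset.card_image_of_injective _ (app_injective _), ← Finset.card_union_add_card_inter,
    hunion, hinter]

end Components

end

lemma sum_range_choose_succ (n d : ℕ) :
    ∑ i ∈ Finset.range (d + 1), (n + 1).choose i =
      ∑ i ∈ Finset.range (d + 1), n.choose i + ∑ i ∈ Finset.range d, n.choose i := by
  rw [Finset.sum_range_succ', Finset.sum_range_succ' (fun i => n.choose i)]
  simp only [Nat.choose_succ_succ, Finset.sum_add_distrib, Nat.choose_zero_right]
  ring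

/-- **lifting.** Let `C ⊆ {0,1}^n` be `d`-maximum (`1 ≤ d ≤ n`), let
`C' ⊆ C` be `(d-1)`-maximum, and let `Comp` enumerate the `C'`-connected components of
`C`. Then for every choice of bits `p`, the lifted class
`(C' × {0,1}) ∪ ⋃_q (Comp q × {p q}) ⊆ {0,1}^{n+1}` is `d`-maximum. -/
theorem stmt15 (n d : ℕ) (hd : 1 ≤ d) (hdn : d ≤ n)
    (C : Finset (Fin n → Bool)) (hC : IsMaximum C d)
    (C' : Finset (Fin n → Bool)) (hC' : IsMaximum C' (d - 1)) (hsub : C' ⊆ C)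
    (k : ℕ) (Comp : Fin k → Finset (Fin n → Bool)) (hcomp : IsComponents C C' d Comp)
    (p : Fin k → Bool) :
    IsMaximum (LiftClass C' Comp p) d := by
  classical
  have hmem : ∀ x ∈ LiftClass C' Comp p, (fun i : Fin n => x i.castSucc) ∈ C := by
    intro x hx
    obtain ⟨c, b, rfl, hc⟩ := mem_liftClass.1 hx
    simp only [app_castSucc]
    rcases hc with hc | ⟨q, hc, -⟩
    exacts [hsub hc, hcomp.subset q hc]
  have hcastSucc : ∀ Y : Finset (Fin n),
      Shatters (LiftClass C' Comp p) (Y.map Fin.castSuccEmb) ↔ Shatters C Y := by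
    refine fun Y => ⟨fun h π => ?_, fun h π => ?_⟩
    · obtain ⟨x, hx, hxπ⟩ := h (app π false)
      refine ⟨_, hmem x hx, fun i hi => ?_⟩
      simpa using hxπ i.castSucc (by simpa using hi)
    · obtain ⟨c, hc, hcπ⟩ := h fun i => π i.castSucc
      obtain ⟨q, hq⟩ := hcomp.exists_mem hC hc
      refine ⟨app c (p q), mem_liftClass.2 ⟨c, _, rfl, .inr ⟨q, hq, rfl⟩⟩, fun i hi => ?_⟩
      obtain ⟨j, hj, rfl⟩ := Finset.mem_map.1 hi
      simpa using hcπ j hj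
  refine ⟨⟨?_, fun Y hY => ?_⟩, ?_⟩
  · obtain ⟨Y, hYd, hY⟩ := hC.1.1
    exact ⟨Y.map Fin.castSuccEmb, by rw [Finset.card_map, hYd], (hcastSucc Y).2 hY⟩
  · set I : Finset (Fin n) := Finset.univ.filter fun i => i.castSucc ∈ Y
    have hIY : I.map Fin.castSuccEmb ⊆ Y := fun i hi => by
      obtain ⟨j, hj, rfl⟩ := Finset.mem_map.1 hi
      simpa [I] using hj
    have hYI : Y ⊆ insert (Fin.last n) (I.map Fin.castSuccEmb) := fun i hi => by
      rcases Fin.eq_castSucc_or_eq_last i with ⟨j, rfl⟩ | rfl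
      · exact Finset.mem_insert_of_mem (Finset.mem_map_of_mem _ (by simpa [I] using hi))
      · exact Finset.mem_insert_self _ _
    have hId : I.card ≤ d := hC.1.2 I ((hcastSucc I).1 (hY.mono_right hIY))
    by_cases hlast : Fin.last n ∈ Y
    · rcases hId.lt_or_eq with hlt | heq
      · have h1 := Finset.card_le_card hYI
        have h2 := Finset.card_insert_le (Fin.last n) (I.map Fin.castSuccEmb)
        rw [Finset.card_map] at h2
        omega
      exfalso
      have hnot : ¬ Shatters C' I := fun h => by
        have := hC'.1.2 I h
        omega
      simp only [Shatters, not_forall, not_exists, not_and] at hnot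
      obtain ⟨π, hπ⟩ := hnot
      have hDC' : ∀ x ∈ C.filter (fun c => ∀ i ∈ I, c i = π i), x ∉ C' := fun x hx hx' => by
        obtain ⟨i, hi, hne⟩ := hπ x hx'
        exact hne ((Finset.mem_filter.1 hx).2 i hi)
      have key : ∀ b, ∃ c ∈ C.filter (fun c => ∀ i ∈ I, c i = π i),
          ∃ q, c ∈ Comp q ∧ p q = b := by
        intro b
        obtain ⟨x, hx, hxπ⟩ := hY (app π b)
        have hxC := hmem x hx
        obtain ⟨c, b', rfl, hc⟩ := mem_liftClass.1 hx
        obtain rfl : b' = b := by simpa using hxπ _ hlast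
        have hcD : c ∈ C.filter (fun c => ∀ i ∈ I, c i = π i) := by
          refine Finset.mem_filter.2 ⟨by simpa using hxC, fun i hi => ?_⟩
          simpa using hxπ i.castSucc (by simpa [I] using hi)
        exact ⟨c, hcD, hc.resolve_left (hDC' c hcD)⟩
      obtain ⟨x, hxD, q, hxq, hq⟩ := key false
      obtain ⟨y, hyD, q', hyq', hq'⟩ := key true
      obtain rfl := hcomp.eq_of_isExtremal hC (hC.isExtremal.filter_forall_eq I π)
        (Finset.filter_subset _ _) hDC' hxD hyD hxq hyq'
      simp [hq] at hq'
    · rw [Finset.subset_insert_iff_of_notMem hlast] at hYI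
      exact (Finset.card_le_card hYI).trans (by rwa [Finset.card_map])
  · rw [hcomp.card_liftClass hC hsub, hC.2, hC'.2, Nat.sub_add_cancel hd,
      sum_range_choose_succ]

end GeomCompress
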